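/- (Boundedness and coercivity of the energy bilinear form.) Let B(u,v) = ½∫_Ω (λ div(u^s)div(v^s) + 2μ ε(u^s):ε(v^s) + r div(u^f)div(v^f)) dx + ½∫_Ω q(div(u^f)div(v^s) + div(v^f)div(u^s)) dx on V(Ω) = (H¹(Ω))³ × H(div;Ω) (with u^s ∈ H₀¹ in the coercivity statement), and for η > 0 set B_η(u,v) = B(u,v) + η(u,v)_{L²}. Assume μ > 0, λ + μ > 0, r, q > 0 on Ω̄ and that the symmetric matrix ((λ, q),(q, r)) is uniformly positive definite (λr − q² > 0). Then there exists a sufficiently large η and constants C₁, C₂ > 0 such that (i) |B_η(u,v)| ≤ C₁‖u‖_{V(Ω)}‖v‖_{V(Ω)} for all u, v ∈ V(Ω), and (ii) B_η(u,u) ≥ C₂‖u‖²_{V(Ω)} for all u ∈ V(Ω) with u^s ∈ (H₀¹(Ω))³. -/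

import Mathlib

noncomputable section

open MeasureTheory Real Set

/-- Spatial points of `ℝ³`. -/
abbrev V3 := Fin 3 → ℝ

/-- Space-time points `z = (t, x)` with `z.1` the time and `z.2` the space variable. -/
abbrev P4 := ℝ × V3

/-- The unit time direction in space-time. -/
def et : P4 := (1, 0)

/-- The `i`-th unit spatial direction in space-time. -/
def ex (i : Fin 3) : P4 := (0, Pi.single i 1)

/-- Directional derivative of a scalar function on space-time. -/
def pd (f : P4 → ℝ) (d : P4) : P4 → ℝ := fun z => fderiv ℝ f z d

/-- Spatial partial derivative of a scalar function on `ℝ³`. -/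
def pdx (c : V3 → ℝ) (i : Fin 3) : V3 → ℝ := fun x => fderiv ℝ c x (Pi.single i 1)

/-- Time derivative `∂ₜ` of a space-time vector field (componentwise). -/
def Dt (u : P4 → V3) : P4 → V3 := fun z i => pd (fun y => u y i) et z

/-- Second time derivative `∂ₜ²` of a scalar function on space-time. -/
def dtt (f : P4 → ℝ) : P4 → ℝ := pd (pd f et) et

/-- Spatial divergence of a space-time vector field. -/
def sdiv (u : P4 → V3) : P4 → ℝ := fun z => ∑ i, pd (fun y => u y i) (ex i) z

/-- Spatial divergence of a vector field on `ℝ³`. -/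
def sdivX (u : V3 → V3) : V3 → ℝ := fun x => ∑ i, pdx (fun y => u y i) i x

/-- Spatial Laplacian of a scalar function on space-time. -/
def slap (f : P4 → ℝ) : P4 → ℝ := fun z => ∑ i, pd (pd f (ex i)) (ex i) z

/-- The elasticity operator `Δ_{μ,λ}v = μΔv + (μ+λ)∇(div v) + (div v)∇λ + (∇v + (∇v)ᵀ)∇μ`. -/
def lameOp (μ lam : V3 → ℝ) (u : P4 → V3) : P4 → V3 := fun z i =>
  μ z.2 * slap (fun y => u y i) z
    + (μ z.2 + lam z.2) * pd (sdiv u) (ex i) z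
    + sdiv u z * pdx lam i z.2
    + ∑ j, (pd (fun y => u y i) (ex j) z + pd (fun y => u y j) (ex i) z) * pdx μ j z.2

/-- Biot's system of poro-elasticity on the space-time set `Q`, with solid displacement `us`,
fluid displacement `uf` and sources `F1, F2`. -/
def BiotSystem (ρ11 ρ12 ρ22 μ lam q r : V3 → ℝ)
    (us uf F1 F2 : P4 → V3) (Q : Set P4) : Prop :=
  ∀ z ∈ Q, ∀ i : Fin 3,
    (ρ11 z.2 * dtt (fun y => us y i) z + ρ12 z.2 * dtt (fun y => uf y i) z
        - lameOp μ lam us z i - pd (fun y => q y.2 * sdiv uf y) (ex i) z = F1 z i)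
    ∧ (ρ12 z.2 * dtt (fun y => us y i) z + ρ22 z.2 * dtt (fun y => uf y i) z
        - pd (fun y => q y.2 * sdiv us y) (ex i) z
        - pd (fun y => r y.2 * sdiv uf y) (ex i) z = F2 z i)

/-- The squared Euclidean distance `|x - x₀|²`. -/
def sqd (x0 x : V3) : ℝ := ∑ i, (x i - x0 i) ^ 2

/-- The Carleman weight `φ(x,t) = exp(γ(|x-x₀|² - βt²))`. -/
def wphi (x0 : V3) (β γ : ℝ) (z : P4) : ℝ := Real.exp (γ * (sqd x0 z.2 - β * z.1 ^ 2))

/-- The spatial weight `ρ(x) = exp(γ|x-x₀|²)`. -/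
def wrho (x0 : V3) (γ : ℝ) (x : V3) : ℝ := Real.exp (γ * sqd x0 x)

/-- The admissible class `𝒞(m,θ)` of coefficients (with lower bound `cstar`). -/
def CClass (Ω : Set V3) (x0 : V3) (m θ cstar : ℝ) (c : V3 → ℝ) : Prop :=
  ContDiff ℝ 2 c ∧ (0 < cstar) ∧ (∀ x ∈ closure Ω, cstar < c x) ∧
    (∀ x ∈ closure Ω,
      |c x| ≤ m ∧ ‖fderiv ℝ c x‖ ≤ m ∧ ‖iteratedFDeriv ℝ 2 c x‖ ≤ m) ∧
    (∀ x ∈ closure Ω, (∑ i, pdx c i x * (x i - x0 i)) / (2 * c x) ≤ 1 - θ)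

/-- Assumption A.1 on the coefficients of Biot's system. -/
def AssumpA1 (Ω : Set V3) (ρ11 ρ12 ρ22 μ lam q r : V3 → ℝ) : Prop :=
  ContDiff ℝ 2 ρ11 ∧ ContDiff ℝ 2 ρ12 ∧ ContDiff ℝ 2 ρ22 ∧ ContDiff ℝ 2 μ ∧
    ContDiff ℝ 2 lam ∧ ContDiff ℝ 2 q ∧ ContDiff ℝ 2 r ∧
    (∀ x ∈ closure Ω, 0 < ρ11 x ∧ 0 < ρ22 x ∧ 0 < q x ∧ 0 < r x ∧
      0 < μ x ∧ 0 < lam x + μ x) ∧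
    (∀ x ∈ closure Ω, 0 < ρ11 x * ρ22 x - ρ12 x ^ 2) ∧
    (∀ x ∈ closure Ω, 0 < lam x * r x - q x ^ 2)

/-- The matrix `A(x)` of (1.9). -/
def Amat (ρ11 ρ12 ρ22 μ lam q r : V3 → ℝ) (x : V3) : Matrix (Fin 2) (Fin 2) ℝ :=
  (ρ11 x * ρ22 x - ρ12 x ^ 2)⁻¹ •
    (Matrix.of ![![ρ22 x, -ρ12 x], ![-ρ12 x, ρ11 x]] *
      Matrix.of ![![2 * μ x + lam x, q x], ![q x, r x]])

/-- Assumption A.2: `A(x)` has two distinct positive eigenvalues `μ₂(x) ≠ μ₃(x)`, and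
`μ₁ = ϱ⁻¹ϱ₂₂μ`, `μ₂`, `μ₃` all belong to the class `𝒞(m,θ)`. -/
def AssumpA2 (Ω : Set V3) (x0 : V3) (ρ11 ρ12 ρ22 μ lam q r μ2 μ3 : V3 → ℝ)
    (m θ c1 c2 c3 : ℝ) : Prop :=
  (∀ x ∈ closure Ω,
      (Amat ρ11 ρ12 ρ22 μ lam q r x - μ2 x • (1 : Matrix (Fin 2) (Fin 2) ℝ)).det = 0 ∧
      (Amat ρ11 ρ12 ρ22 μ lam q r x - μ3 x • (1 : Matrix (Fin 2) (Fin 2) ℝ)).det = 0 ∧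
      0 < μ2 x ∧ 0 < μ3 x ∧ μ2 x ≠ μ3 x) ∧
    CClass Ω x0 m θ c1 (fun x => (ρ11 x * ρ22 x - ρ12 x ^ 2)⁻¹ * ρ22 x * μ x) ∧
    CClass Ω x0 m θ c2 μ2 ∧ CClass Ω x0 m θ c3 μ3

/-- `d² = min_{Ω̄} |x-x₀|²` and `D² = max_{Ω̄} |x-x₀|²`. -/
def dGeom (Ω : Set V3) (x0 : V3) (d D : ℝ) : Prop :=
  0 ≤ d ∧ 0 ≤ D ∧ IsLeast ((fun x => sqd x0 x) '' closure Ω) (d ^ 2) ∧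
    IsGreatest ((fun x => sqd x0 x) '' closure Ω) (D ^ 2)

/-- Condition (1.16) on the parameter `β` (with `D₀ = √(D² - d²)`). -/
def BetaCond (m θ c0 d D β : ℝ) : Prop :=
  0 < β ∧ β + (m * Real.sqrt (D ^ 2 - d ^ 2) / Real.sqrt c0) * Real.sqrt β < θ * c0 ∧
    0 < c0 * d ^ 2 - β * D ^ 2

/-- Squared Euclidean norm of a vector of `ℝ³`. -/
def n2 (v : V3) : ℝ := ∑ i, (v i) ^ 2

/-- Squared space-time gradient `|∇_{x,t} f|²` of a scalar function. -/
def gradT2 (f : P4 → ℝ) (z : P4) : ℝ := (pd f et z) ^ 2 + ∑ j, (pd f (ex j) z) ^ 2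

/-- Squared spatial gradient `|∇f|²` of a scalar function on space-time. -/
def gradX2 (f : P4 → ℝ) (z : P4) : ℝ := ∑ j, (pd f (ex j) z) ^ 2

/-- Squared space-time gradient of a vector field. -/
def vGradT2 (u : P4 → V3) (z : P4) : ℝ := ∑ i, gradT2 (fun y => u y i) z

/-- Squared spatial gradient of a vector field. -/
def vGradX2 (u : P4 → V3) (z : P4) : ℝ := ∑ i, gradX2 (fun y => u y i) z

/-- The weighted Carleman functional appearing on the left-hand side of the Carleman
estimate for Biot's system (also denoted `N_{τ,φ}(v)`). -/
def CarlemanN (x0 : V3) (β γ τ : ℝ) (us uf : P4 → V3) (Q : Set P4) : ℝ :=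
  ∫ z in Q,
    (τ * (vGradT2 us z + gradT2 (sdiv us) z + gradT2 (sdiv uf) z)
      + τ ^ 3 * (n2 (us z) + (sdiv us z) ^ 2 + (sdiv uf z) ^ 2))
      * Real.exp (2 * τ * wphi x0 β γ z)

/-- The weighted source term `∫_Q (|F|² + |∇F|²) e^{2τφ}`. -/
def srcN (x0 : V3) (β γ τ : ℝ) (F1 F2 : P4 → V3) (Q : Set P4) : ℝ :=
  ∫ z in Q,
    (n2 (F1 z) + n2 (F2 z) + vGradX2 F1 z + vGradX2 F2 z)
      * Real.exp (2 * τ * wphi x0 β γ z)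

/-- Squared `H²`-norm of a space-time vector field over a set. -/
def H2sq (w : P4 → V3) (S : Set P4) : ℝ :=
  ∫ z in S, (‖w z‖ ^ 2 + ‖fderiv ℝ w z‖ ^ 2 + ‖iteratedFDeriv ℝ 2 w z‖ ^ 2)

/-- The observation quantity `E_ω(u) = Σ_{j=2}^3 ‖∂ₜʲu‖²_{H²(ω×(-T,T))}`. -/
def Eobs (us uf : P4 → V3) (S : Set P4) : ℝ :=
  H2sq (Dt (Dt us)) S + H2sq (Dt (Dt uf)) S
    + H2sq (Dt (Dt (Dt us))) S + H2sq (Dt (Dt (Dt uf))) S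

/-- Squared `H₀¹(Ω)`-norm of a scalar function. -/
def H01sq (Ω : Set V3) (p : V3 → ℝ) : ℝ :=
  ∫ x in Ω, ((p x) ^ 2 + ∑ i, (pdx p i x) ^ 2)


/-- The symmetrized gradient `ε(u)ᵢⱼ = ½(∂ⱼuᵢ + ∂ᵢuⱼ)` of a spatial vector field. -/
def epsSym (u : V3 → V3) (i j : Fin 3) (x : V3) : ℝ :=
  (pdx (fun y => u y i) j x + pdx (fun y => u y j) i x) / 2

/-- The energy bilinear form `B(u,v)` of Biot's system on `V(Ω)`. -/
def Bform (Ω : Set V3) (μ lam q r : V3 → ℝ) (u1 u2 v1 v2 : V3 → V3) : ℝ :=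
  (1 / 2) * ∫ x in Ω,
    (lam x * sdivX u1 x * sdivX v1 x
      + 2 * μ x * ∑ i, ∑ j, epsSym u1 i j x * epsSym v1 i j x
      + r x * sdivX u2 x * sdivX v2 x
      + q x * (sdivX u2 x * sdivX v1 x + sdivX v2 x * sdivX u1 x))

/-- The `L²(Ω)` inner product of two pairs of vector fields. -/
def L2ip (Ω : Set V3) (u1 u2 v1 v2 : V3 → V3) : ℝ :=
  ∫ x in Ω, (∑ i, u1 x i * v1 x i + ∑ i, u2 x i * v2 x i)

/-- The squared `V(Ω) = (H¹(Ω))³ × H(div;Ω)` norm of a pair `(u¹, u²)`. -/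
def Vsq (Ω : Set V3) (u1 u2 : V3 → V3) : ℝ :=
  ∫ x in Ω, (n2 (u1 x) + ∑ i, ∑ j, (pdx (fun y => u1 y i) j x) ^ 2
    + n2 (u2 x) + (sdivX u2 x) ^ 2)

/-- Membership (sufficient regularity and integrability) of a pair in `V(Ω)`. -/
def VMem (Ω : Set V3) (u1 u2 : V3 → V3) : Prop :=
  ContDiff ℝ 1 u1 ∧ ContDiff ℝ 1 u2 ∧
    IntegrableOn (fun x => n2 (u1 x) + ∑ i, ∑ j, (pdx (fun y => u1 y i) j x) ^ 2
      + n2 (u2 x) + (sdivX u2 x) ^ 2) Ω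

open Filter Topology in
/-- For Lipschitz compactly supported `f` and `g`, directional derivatives can be exchanged in
`∫ ∂ᵥf ∂_w g`. -/
theorem integral_lineDeriv_mul_lineDeriv_comm {E : Type*} [NormedAddCommGroup E] [NormedSpace ℝ E]
    [MeasurableSpace E] [BorelSpace E] [FiniteDimensional ℝ E] (ν : Measure E)
    [ν.IsAddHaarMeasure] {f g : E → ℝ} {C D : NNReal}
    (hf : LipschitzWith C f) (hfc : HasCompactSupport f)
    (hg : LipschitzWith D g) (hgc : HasCompactSupport g) (v w : E) :
    ∫ x, lineDeriv ℝ f x v * lineDeriv ℝ g x w ∂ν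
      = ∫ x, lineDeriv ℝ f x w * lineDeriv ℝ g x v ∂ν := by
  have integrable_lineDeriv : ∀ {h : E → ℝ} {K : NNReal}, LipschitzWith K h →
      HasCompactSupport h → ∀ u : E, Integrable (fun x => lineDeriv ℝ h x u) ν := by
    intro h K hh hhc u
    have hsupp : Function.support (fun x => lineDeriv ℝ h x u) ⊆ tsupport h := by
      intro x hx
      by_contra hxn
      apply hx
      have : h =ᶠ[𝓝 x] 0 := notMem_tsupport_iff_eventuallyEq.1 hxn
      change lineDeriv ℝ h x u = 0
      rw [this.lineDeriv_eq]
      simp [lineDeriv]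
    rw [← integrableOn_iff_integrable_of_support_subset hsupp]
    exact (hh.locallyIntegrable_lineDeriv u).integrableOn_isCompact hhc
  have hgi := integrable_lineDeriv hg hgc w
  have hfi := integrable_lineDeriv hf hfc (-w)
  have A := hf.integral_inv_smul_sub_mul_tendsto_integral_lineDeriv_mul hgi v
  have B := hg.integral_inv_smul_sub_mul_tendsto_integral_lineDeriv_mul hfi (-v)
  have shift : ∀ a : E, ∫ x, f (x + a) * lineDeriv ℝ g x w ∂ν
      = ∫ x, lineDeriv ℝ f x (-w) * g (x - a) ∂ν := by
    intro a
    have hfa : LipschitzWith C (fun x => f (x + a)) := by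
      exact LipschitzWith.of_dist_le_mul fun x y => by
        simpa using hf.dist_le_mul (x + a) (y + a)
    have hfac : HasCompactSupport (fun x => f (x + a)) :=
      hfc.comp_homeomorph (Homeomorph.addRight a)
    have h1 := LipschitzWith.integral_lineDeriv_mul_eq (μ := ν) hg hfa hfac w
    have h2 : ∀ x, lineDeriv ℝ (fun x => f (x + a)) x (-w) = lineDeriv ℝ f (x + a) (-w) := by
      intro x
      simp only [lineDeriv, add_right_comm]
    simp only [h2] at h1
    have h3 := integral_add_right_eq_self (μ := ν)
      (fun x => lineDeriv ℝ f x (-w) * g (x - a)) a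
    simp only [add_sub_cancel_right] at h3
    rw [← h3, ← h1]
    exact integral_congr_ae (.of_forall fun x => mul_comm _ _)
  obtain ⟨Bf, hBf⟩ := hf.continuous.bounded_above_of_compact_support hfc
  obtain ⟨Bg, hBg⟩ := hg.continuous.bounded_above_of_compact_support hgc
  have if1 : ∀ a : E, Integrable (fun x => f (x + a) * lineDeriv ℝ g x w) ν := fun a =>
    hgi.bdd_mul (hf.continuous.comp (continuous_add_const a)).aestronglyMeasurable
      (.of_forall fun x => hBf _)
  have ig1 : ∀ a : E, Integrable (fun x => lineDeriv ℝ f x (-w) * g (x - a)) ν := fun a =>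
    hfi.mul_bdd (hg.continuous.comp (continuous_sub_right a)).aestronglyMeasurable
      (.of_forall fun x => hBg _)
  have key : ∀ t : ℝ, ∫ x, (t⁻¹ • (f (x + t • v) - f x)) * lineDeriv ℝ g x w ∂ν
      = ∫ x, (t⁻¹ • (g (x + t • (-v)) - g x)) * lineDeriv ℝ f x (-w) ∂ν := by
    intro t
    have e1 := shift (t • v)
    have e0 := shift 0
    have s1 := integral_sub (if1 (t • v)) (if1 0)
    have s2 := integral_sub (ig1 (t • v)) (ig1 0)
    rw [e1, e0, ← s2] at s1
    simp only [smul_eq_mul, mul_assoc, integral_const_mul]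
    congr 1
    simp only [add_zero, sub_zero] at s1
    simpa only [sub_mul, mul_sub, smul_neg, ← sub_eq_add_neg,
      mul_comm (lineDeriv ℝ f _ (-w))] using s1
  simp only [key] at A
  rw [tendsto_nhds_unique A B]
  refine integral_congr_ae (.of_forall fun x => ?_)
  simp only [lineDeriv_neg]
  ring

/-- The derivative of a function vanishes at almost every point of its zero set at which the
function is differentiable. -/
theorem ae_lineDeriv_eq_zero_of_eqOn_zero {E : Type*} [NormedAddCommGroup E] [NormedSpace ℝ E]
    [MeasurableSpace E] [BorelSpace E] [FiniteDimensional ℝ E] (ν : Measure E)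
    [ν.IsAddHaarMeasure] {f : E → ℝ} {s : Set E} (hs : MeasurableSet s) (hf : EqOn f 0 s)
    (w : E) : ∀ᵐ x ∂ν, x ∈ s → DifferentiableAt ℝ f x → lineDeriv ℝ f x w = 0 := by
  rcases eq_or_ne w 0 with rfl | hw
  · exact .of_forall fun x _ _ => lineDeriv_zero
  have hs' : MeasurableSet (s ∩ {x | DifferentiableAt ℝ f x}) :=
    hs.inter (measurableSet_of_differentiableAt ℝ f)
  have happrox : ApproximatesLinearOn (fun x => f x • w) (0 : E →L[ℝ] E)
      (s ∩ {x | DifferentiableAt ℝ f x}) 0 := by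
    intro x hx y hy
    simp [hf hx.1, hf hy.1]
  have h := happrox.norm_fderiv_sub_le ν hs' (fun x => (fderiv ℝ f x).smulRight w)
    (fun x hx => (hx.2.hasFDerivAt.smul_const w).hasFDerivWithinAt)
  rw [ae_restrict_iff' hs'] at h
  filter_upwards [h] with x hx hxs hxd
  have hzero : fderiv ℝ f x = 0 := by
    simpa [hw] using hx ⟨hxs, hxd⟩
  simp [hxd.lineDeriv_eq_fderiv, hzero]

/-- The extension by zero of a `C¹` function vanishing on the boundary of a bounded open set is
Lipschitz. -/
theorem exists_lipschitzWith_indicator {E : Type*} [NormedAddCommGroup E] [NormedSpace ℝ E]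
    [FiniteDimensional ℝ E] {Ω : Set E} (hΩ : IsOpen Ω) (hb : Bornology.IsBounded Ω) {f : E → ℝ}
    (hf : ContDiff ℝ 1 f) (h0 : ∀ x ∈ frontier Ω, f x = 0) :
    ∃ C, LipschitzWith C (Ω.indicator f) := by
  obtain ⟨R, hR⟩ := hb.subset_closedBall (0 : E)
  have hcl : closure Ω ⊆ Metric.closedBall 0 R := closure_minimal hR Metric.isClosed_closedBall
  obtain ⟨C, hC⟩ := (isCompact_closedBall (0 : E) R).exists_bound_of_continuousOn
    (hf.continuous_fderiv one_ne_zero).continuousOn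
  have hLip : LipschitzOnWith C.toNNReal f (Metric.closedBall 0 R) :=
    (convex_closedBall (0 : E) R).lipschitzOnWith_of_nnnorm_fderiv_le
      (fun x _ => (hf.differentiable one_ne_zero).differentiableAt)
      (fun x hx => by
        rw [← NNReal.coe_le_coe, coe_nnnorm]
        exact (hC x hx).trans (Real.le_coe_toNNReal C))
  have cross : ∀ x ∈ Ω, ∀ y ∉ Ω, |f x| ≤ C.toNNReal * dist x y := by
    intro x hx y hy
    obtain ⟨z, hzs, hzf⟩ : (segment ℝ x y ∩ frontier Ω).Nonempty := by
      by_contra hne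
      rw [Set.not_nonempty_iff_eq_empty] at hne
      have hnot : ∀ z ∈ segment ℝ x y, z ∈ closure Ω → z ∈ Ω := by
        intro z hz hzc
        by_contra hzn
        have : z ∈ segment ℝ x y ∩ frontier Ω := ⟨hz, hzc, by rwa [hΩ.interior_eq]⟩
        simp [hne] at this
      obtain ⟨z, -, hz1, hz2⟩ := (convex_segment x y).isPreconnected Ω (closure Ω)ᶜ hΩ
        isClosed_closure.isOpen_compl
        (fun z hz => by
          by_cases hzc : z ∈ closure Ω
          · exact Or.inl (hnot z hz hzc)
          · exact Or.inr hzc)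
        ⟨x, left_mem_segment ℝ x y, hx⟩
        ⟨y, right_mem_segment ℝ x y, fun hyc => hy (hnot y (right_mem_segment ℝ x y) hyc)⟩
      exact hz2 (subset_closure hz1)
    have hxz := hLip.dist_le_mul x (hR hx) z (hcl hzf.1)
    rw [h0 z hzf, Real.dist_eq, sub_zero] at hxz
    refine hxz.trans (mul_le_mul_of_nonneg_left ?_ C.toNNReal.2)
    have := dist_add_dist_of_mem_segment hzs
    linarith [dist_nonneg (x := z) (y := y)]
  refine ⟨C.toNNReal, LipschitzWith.of_dist_le_mul fun x y => ?_⟩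
  by_cases hx : x ∈ Ω <;> by_cases hy : y ∈ Ω <;>
    simp only [hx, hy, indicator_of_mem, indicator_of_notMem, not_false_eq_true, Real.dist_eq,
      sub_zero, zero_sub, abs_neg, sub_self, abs_zero]
  · exact hLip.dist_le_mul x (hR hx) y (hR hy)
  · exact cross x hx y hy
  · rw [dist_comm]; exact cross y hy x hx
  · positivity

/-- The derivative of the extension by zero is almost everywhere the extension by zero of the
derivative. -/
theorem ae_lineDeriv_indicator {E : Type*} [NormedAddCommGroup E] [NormedSpace ℝ E]
    [MeasurableSpace E] [BorelSpace E] [FiniteDimensional ℝ E] (ν : Measure E)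
    [ν.IsAddHaarMeasure] {Ω : Set E} (hΩ : IsOpen Ω) {f : E → ℝ} (hf : Differentiable ℝ f)
    {C : NNReal} (hL : LipschitzWith C (Ω.indicator f)) (v : E) :
    ∀ᵐ x ∂ν, lineDeriv ℝ (Ω.indicator f) x v = Ω.indicator (fun x => fderiv ℝ f x v) x := by
  filter_upwards [hL.ae_differentiableAt (μ := ν),
    ae_lineDeriv_eq_zero_of_eqOn_zero ν (f := Ω.indicator f) hΩ.measurableSet.compl
      (fun x hx => indicator_of_notMem hx f) v] with x hd h0
  by_cases hx : x ∈ Ω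
  · have heq : Ω.indicator f =ᶠ[nhds x] f := by
      filter_upwards [hΩ.mem_nhds hx] with y hy using indicator_of_mem hy f
    rw [indicator_of_mem hx, heq.lineDeriv_eq, hf.differentiableAt.lineDeriv_eq_fderiv]
  · rw [indicator_of_notMem hx, h0 hx hd]

/-- Exchange of partial derivatives in `∫_Ω ∂ᵥf ∂_w g` for functions vanishing on `∂Ω`. -/
theorem setIntegral_fderiv_mul_fderiv_comm {E : Type*} [NormedAddCommGroup E] [NormedSpace ℝ E]
    [MeasurableSpace E] [BorelSpace E] [FiniteDimensional ℝ E] (ν : Measure E)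
    [ν.IsAddHaarMeasure] {Ω : Set E} (hΩ : IsOpen Ω) (hb : Bornology.IsBounded Ω) {f g : E → ℝ}
    (hf : ContDiff ℝ 1 f) (hf0 : ∀ x ∈ frontier Ω, f x = 0)
    (hg : ContDiff ℝ 1 g) (hg0 : ∀ x ∈ frontier Ω, g x = 0) (v w : E) :
    ∫ x in Ω, fderiv ℝ f x v * fderiv ℝ g x w ∂ν
      = ∫ x in Ω, fderiv ℝ f x w * fderiv ℝ g x v ∂ν := by
  obtain ⟨C, hC⟩ := exists_lipschitzWith_indicator hΩ hb hf hf0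
  obtain ⟨D, hD⟩ := exists_lipschitzWith_indicator hΩ hb hg hg0
  have hsupp : ∀ h : E → ℝ, HasCompactSupport (Ω.indicator h) := fun h =>
    HasCompactSupport.intro hb.isCompact_closure
      fun x hx => indicator_of_notMem (fun hx' => hx (subset_closure hx')) h
  have extend : ∀ a b : E, ∫ x in Ω, fderiv ℝ f x a * fderiv ℝ g x b ∂ν
      = ∫ x, lineDeriv ℝ (Ω.indicator f) x a * lineDeriv ℝ (Ω.indicator g) x b ∂ν := by
    intro a b
    rw [← integral_indicator hΩ.measurableSet]
    apply integral_congr_ae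
    filter_upwards [ae_lineDeriv_indicator ν hΩ (hf.differentiable one_ne_zero) hC a,
      ae_lineDeriv_indicator ν hΩ (hg.differentiable one_ne_zero) hD b] with x h1 h2
    rw [h1, h2]
    by_cases hx : x ∈ Ω <;> simp [hx]
  rw [extend, extend]
  exact integral_lineDeriv_mul_lineDeriv_comm ν hC (hsupp f) hD (hsupp g) v w

/-- A function continuous on the closure of a bounded set is integrable on that set. -/
theorem integrableOn_of_continuousOn_closure {Ω : Set V3} (hb : Bornology.IsBounded Ω)
    {f : V3 → ℝ} (hf : ContinuousOn f (closure Ω)) : IntegrableOn f Ω :=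
  (hf.integrableOn_compact hb.isCompact_closure).mono_set subset_closure

theorem continuous_pdx_apply {u : V3 → V3} (hu : ContDiff ℝ 1 u) (i j : Fin 3) :
    Continuous (pdx (fun y => u y i) j) := by
  have h : ContDiff ℝ 1 (fun y => u y i) := contDiff_pi.1 hu i
  exact (h.continuous_fderiv one_ne_zero).clm_apply continuous_const

theorem continuous_sdivX {u : V3 → V3} (hu : ContDiff ℝ 1 u) : Continuous (sdivX u) :=
  continuous_finsetSum _ fun i _ => continuous_pdx_apply hu i i

theorem continuous_epsSym {u : V3 → V3} (hu : ContDiff ℝ 1 u) (i j : Fin 3) :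
    Continuous (epsSym u i j) :=
  ((continuous_pdx_apply hu i j).add (continuous_pdx_apply hu j i)).div_const 2

/-- Korn's first inequality for `C¹` vector fields vanishing on the boundary. -/
theorem korn_inequality {Ω : Set V3} (hΩ : IsOpen Ω) (hb : Bornology.IsBounded Ω) {u : V3 → V3}
    (hu : ContDiff ℝ 1 u) (h0 : ∀ x ∈ frontier Ω, u x = 0) :
    ∫ x in Ω, ∑ i, ∑ j, (pdx (fun y => u y i) j x) ^ 2
      ≤ 2 * ∫ x in Ω, ∑ i, ∑ j, epsSym u i j x * epsSym u i j x := by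
  have hp := continuous_pdx_apply hu
  have integrableOn : ∀ {f : V3 → ℝ}, Continuous f → IntegrableOn f Ω := fun hf =>
    integrableOn_of_continuousOn_closure hb hf.continuousOn
  have hcross : 0 ≤ ∫ x in Ω, ∑ i, ∑ j, pdx (fun y => u y i) j x * pdx (fun y => u y j) i x := by
    have heq : ∫ x in Ω, ∑ i, ∑ j, pdx (fun y => u y i) j x * pdx (fun y => u y j) i x
        = ∫ x in Ω, ∑ i, ∑ j, pdx (fun y => u y i) i x * pdx (fun y => u y j) j x := by
      rw [integral_finsetSum _ fun i _ => integrableOn (by fun_prop),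
        integral_finsetSum _ fun i _ => integrableOn (by fun_prop)]
      refine Finset.sum_congr rfl fun i _ => ?_
      rw [integral_finsetSum _ fun j _ => integrableOn (by fun_prop),
        integral_finsetSum _ fun j _ => integrableOn (by fun_prop)]
      refine Finset.sum_congr rfl fun j _ => ?_
      exact setIntegral_fderiv_mul_fderiv_comm volume hΩ hb (contDiff_pi.1 hu i)
        (fun x hx => by simp [h0 x hx]) (contDiff_pi.1 hu j) (fun x hx => by simp [h0 x hx])
        (Pi.single j 1) (Pi.single i 1)
    rw [heq]
    refine integral_nonneg fun x => ?_
    simp only [← Finset.sum_mul_sum]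
    exact mul_self_nonneg _
  have hsum : 2 * ∫ x in Ω, ∑ i, ∑ j, epsSym u i j x * epsSym u i j x
      = (∫ x in Ω, ∑ i, ∑ j, (pdx (fun y => u y i) j x) ^ 2)
        + ∫ x in Ω, ∑ i, ∑ j, pdx (fun y => u y i) j x * pdx (fun y => u y j) i x := by
    rw [← integral_const_mul,
      ← integral_add (integrableOn (by fun_prop)) (integrableOn (by fun_prop))]
    refine integral_congr_ae (.of_forall fun x => ?_)
    simp only [epsSym, Fin.sum_univ_three]
    ring
  linarith

/-- The Cauchy-Schwarz inequality for `∫ √f √g`. -/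
theorem integral_sqrt_mul_sqrt_le {α : Type*} [MeasurableSpace α] {ν : Measure α} {f g : α → ℝ}
    (hf : Integrable f ν) (hg : Integrable g ν) (hf0 : 0 ≤ f) (hg0 : 0 ≤ g) :
    ∫ x, √(f x) * √(g x) ∂ν ≤ √(∫ x, f x ∂ν) * √(∫ x, g x ∂ν) := by
  have hmem : ∀ {h : α → ℝ}, Integrable h ν → 0 ≤ h →
      MemLp (fun x => √(h x)) (ENNReal.ofReal 2) ν := by
    intro h hh hh0
    rw [ENNReal.ofReal_ofNat,
      memLp_two_iff_integrable_sq (continuous_sqrt.comp_aestronglyMeasurable hh.1)]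
    simpa only [sq_sqrt (hh0 _)] using hh
  have h := integral_mul_le_Lp_mul_Lq_of_nonneg Real.HolderConjugate.two_two
    (.of_forall fun x => sqrt_nonneg (f x)) (.of_forall fun x => sqrt_nonneg (g x))
    (hmem hf hf0) (hmem hg hg0)
  simpa only [rpow_two, sq_sqrt (hf0 _), sq_sqrt (hg0 _), ← sqrt_eq_rpow] using h

/-- The integrand of the squared `V(Ω)`-norm. -/
def vDensity (u1 u2 : V3 → V3) (x : V3) : ℝ :=
  n2 (u1 x) + ∑ i, ∑ j, (pdx (fun y => u1 y i) j x) ^ 2 + n2 (u2 x) + (sdivX u2 x) ^ 2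

theorem vDensity_nonneg (u1 u2 : V3 → V3) : 0 ≤ vDensity u1 u2 := fun x => by
  simp only [vDensity, n2, Pi.zero_apply]
  positivity

theorem abs_apply_le_sqrt_vDensity (u1 u2 : V3 → V3) (x : V3) :
    (∀ i, |u1 x i| ≤ √(vDensity u1 u2 x)) ∧ (∀ i, |u2 x i| ≤ √(vDensity u1 u2 x)) ∧
      (∀ i j, |pdx (fun y => u1 y i) j x| ≤ √(vDensity u1 u2 x)) ∧
      |sdivX u2 x| ≤ √(vDensity u1 u2 x) := by
  have h1 : 0 ≤ n2 (u1 x) := Finset.sum_nonneg fun i _ => sq_nonneg _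
  have h2 : 0 ≤ n2 (u2 x) := Finset.sum_nonneg fun i _ => sq_nonneg _
  have h3 : ∀ i, 0 ≤ ∑ j, (pdx (fun y => u1 y i) j x) ^ 2 := fun i =>
    Finset.sum_nonneg fun j _ => sq_nonneg _
  have h4 := Finset.sum_nonneg fun i (_ : i ∈ Finset.univ) => h3 i
  have h5 := sq_nonneg (sdivX u2 x)
  have hn : ∀ (v : V3) (i : Fin 3), v i ^ 2 ≤ n2 v := fun v i =>
    Finset.single_le_sum (f := fun i => v i ^ 2) (fun i _ => sq_nonneg _) (Finset.mem_univ i)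
  refine ⟨fun i => abs_le_sqrt ?_, fun i => abs_le_sqrt ?_, fun i j => abs_le_sqrt ?_,
    abs_le_sqrt ?_⟩ <;> unfold vDensity
  · linarith [hn (u1 x) i]
  · linarith [hn (u2 x) i]
  · have e1 := Finset.single_le_sum (f := fun j => pdx (fun y => u1 y i) j x ^ 2)
      (fun j _ => sq_nonneg _) (Finset.mem_univ j)
    have e2 := Finset.single_le_sum (f := fun i => ∑ j, pdx (fun y => u1 y i) j x ^ 2)
      (fun i _ => h3 i) (Finset.mem_univ i)
    linarith
  · linarith

theorem abs_sdivX_epsSym_le_sqrt_vDensity (u1 u2 : V3 → V3) (x : V3) :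
    |sdivX u1 x| ≤ 3 * √(vDensity u1 u2 x) ∧
      ∀ i j, |epsSym u1 i j x| ≤ √(vDensity u1 u2 x) := by
  obtain ⟨-, -, hp, -⟩ := abs_apply_le_sqrt_vDensity u1 u2 x
  constructor
  · refine (Finset.abs_sum_le_sum_abs _ _).trans ((Finset.sum_le_sum fun i _ => hp i i).trans ?_)
    simp
  · intro i j
    have h1 := hp i j
    have h2 := hp j i
    simp only [epsSym]
    rw [abs_le] at h1 h2 ⊢
    constructor <;> linarith [h1.1, h1.2, h2.1, h2.2]

/-- Pointwise bound of the integrand of `B + η(·,·)_{L²}`. -/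
theorem abs_energy_density_le {l m q r M η : ℝ} (hl : |l| ≤ M) (hm : |m| ≤ M) (hq : |q| ≤ M)
    (hr : |r| ≤ M) (hη : 0 ≤ η) (u1 u2 v1 v2 : V3 → V3) (x : V3) :
    |1 / 2 * (l * sdivX u1 x * sdivX v1 x
      + 2 * m * ∑ i, ∑ j, epsSym u1 i j x * epsSym v1 i j x
      + r * sdivX u2 x * sdivX v2 x
      + q * (sdivX u2 x * sdivX v1 x + sdivX v2 x * sdivX u1 x))
      + η * (∑ i, u1 x i * v1 x i + ∑ i, u2 x i * v2 x i)|
    ≤ (17 * M + 6 * η) * (√(vDensity u1 u2 x) * √(vDensity v1 v2 x)) := by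
  obtain ⟨a1, a2, -, a4⟩ := abs_apply_le_sqrt_vDensity u1 u2 x
  obtain ⟨b1, b2, -, b4⟩ := abs_apply_le_sqrt_vDensity v1 v2 x
  obtain ⟨a5, a6⟩ := abs_sdivX_epsSym_le_sqrt_vDensity u1 u2 x
  obtain ⟨b5, b6⟩ := abs_sdivX_epsSym_le_sqrt_vDensity v1 v2 x
  set A := √(vDensity u1 u2 x)
  set B := √(vDensity v1 v2 x)
  have hA : 0 ≤ A := sqrt_nonneg _
  have hB : 0 ≤ B := sqrt_nonneg _
  have hM : 0 ≤ M := (abs_nonneg l).trans hl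
  have hmul : ∀ {a b a' b' : ℝ}, |a| ≤ a' → |b| ≤ b' → |a * b| ≤ a' * b' := by
    intro a b a' b' ha hb
    rw [abs_mul]
    exact mul_le_mul ha hb (abs_nonneg _) ((abs_nonneg _).trans ha)
  have hsum : ∀ {f : Fin 3 → ℝ} {c : ℝ}, (∀ i, |f i| ≤ c) → |∑ i, f i| ≤ 3 * c := by
    intro f c hf
    refine (Finset.abs_sum_le_sum_abs _ _).trans ((Finset.sum_le_sum fun i _ => hf i).trans ?_)
    simp
  have t1 := hmul (hmul hl a5) b5
  have t2 := hmul hm (hsum fun i => hsum fun j => hmul (a6 i j) (b6 i j))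
  have t3 := hmul (hmul hr a4) b4
  have t4 := hmul hq (hmul a4 b5)
  have t5 := hmul hq (hmul b4 a5)
  have t6 := hmul (abs_of_nonneg hη).le (hsum fun i => hmul (a1 i) (b1 i))
  have t7 := hmul (abs_of_nonneg hη).le (hsum fun i => hmul (a2 i) (b2 i))
  rw [abs_le] at *
  constructor <;> linarith [t1.1, t1.2, t2.1, t2.2, t3.1, t3.2, t4.1, t4.2, t5.1, t5.2, t6.1,
    t6.2, t7.1, t7.2]

/-- boundedness and coercivity of `B_η = B + η(·,·)_{L²}`: for sufficiently
large `η` there are `C₁, C₂ > 0` with `|B_η(u,v)| ≤ C₁‖u‖_V‖v‖_V` for all `u, v ∈ V(Ω)` and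
`B_η(u,u) ≥ C₂‖u‖²_V` for all `u ∈ V(Ω)` with `u^s ∈ (H₀¹(Ω))³`. -/
theorem Bform_bounded_coercive (Ω : Set V3) (μ lam q r : V3 → ℝ)
    (hΩopen : IsOpen Ω) (hΩbd : Bornology.IsBounded Ω)
    (hcont : ContinuousOn μ (closure Ω) ∧ ContinuousOn lam (closure Ω) ∧
      ContinuousOn q (closure Ω) ∧ ContinuousOn r (closure Ω))
    (hpos : ∀ x ∈ closure Ω, 0 < μ x ∧ 0 < lam x + μ x ∧ 0 < q x ∧ 0 < r x)
    (hM0 : ∃ γ0 : ℝ, 0 < γ0 ∧ ∀ x ∈ closure Ω, ∀ a b : ℝ,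
      γ0 * (a ^ 2 + b ^ 2) ≤ lam x * a ^ 2 + 2 * q x * a * b + r x * b ^ 2) :
    ∃ η : ℝ, 0 < η ∧ ∃ C1 : ℝ, 0 < C1 ∧ ∃ C2 : ℝ, 0 < C2 ∧
      (∀ u1 u2 v1 v2 : V3 → V3, VMem Ω u1 u2 → VMem Ω v1 v2 →
        |Bform Ω μ lam q r u1 u2 v1 v2 + η * L2ip Ω u1 u2 v1 v2| ≤
          C1 * Real.sqrt (Vsq Ω u1 u2) * Real.sqrt (Vsq Ω v1 v2)) ∧
      (∀ u1 u2 : V3 → V3, VMem Ω u1 u2 → (∀ x ∈ frontier Ω, u1 x = 0) →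
        C2 * Vsq Ω u1 u2 ≤
          Bform Ω μ lam q r u1 u2 u1 u2 + η * L2ip Ω u1 u2 u1 u2) := by
  obtain ⟨hμ, hlam, hq, hr⟩ := hcont
  obtain ⟨γ0, hγ0, hM0⟩ := hM0
  have hK : IsCompact (closure Ω) := hΩbd.isCompact_closure
  have integrableOn : ∀ {f : V3 → ℝ}, ContinuousOn f (closure Ω) → IntegrableOn f Ω := fun hf =>
    integrableOn_of_continuousOn_closure hΩbd hf
  obtain ⟨m, hm0, hm⟩ := hK.exists_forall_le' hμ fun x hx => (hpos x hx).1
  obtain ⟨M1, hM1⟩ := hK.exists_bound_of_continuousOn hμ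
  obtain ⟨M2, hM2⟩ := hK.exists_bound_of_continuousOn hlam
  obtain ⟨M3, hM3⟩ := hK.exists_bound_of_continuousOn hq
  obtain ⟨M4, hM4⟩ := hK.exists_bound_of_continuousOn hr
  set M := max (max M1 M2) (max (max M3 M4) 0) with hMdef
  have hMpos : 0 ≤ M := by simp [hMdef]
  have hfull : ∀ {u1 u2 v1 v2 : V3 → V3}, ContDiff ℝ 1 u1 → ContDiff ℝ 1 u2 →
      ContDiff ℝ 1 v1 → ContDiff ℝ 1 v2 →
      IntegrableOn (fun x => lam x * sdivX u1 x * sdivX v1 x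
        + 2 * μ x * ∑ i, ∑ j, epsSym u1 i j x * epsSym v1 i j x
        + r x * sdivX u2 x * sdivX v2 x
        + q x * (sdivX u2 x * sdivX v1 x + sdivX v2 x * sdivX u1 x)) Ω ∧
      IntegrableOn (fun x => ∑ i, u1 x i * v1 x i + ∑ i, u2 x i * v2 x i) Ω := by
    intro u1 u2 v1 v2 hu1 hu2 hv1 hv2
    have := continuous_sdivX hu1
    have := continuous_sdivX hu2
    have := continuous_sdivX hv1
    have := continuous_sdivX hv2
    have := continuous_epsSym hu1
    have := continuous_epsSym hv1
    have := hu1.continuous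
    have := hu2.continuous
    have := hv1.continuous
    have := hv2.continuous
    exact ⟨integrableOn (by fun_prop), integrableOn (by fun_prop)⟩
  refine ⟨1, one_pos, 17 * M + 6, by positivity, min (γ0 / 2) (min (m / 2) 1), by positivity,
    ?_, ?_⟩
  · intro u1 u2 v1 v2 ⟨hu1, hu2, hui⟩ ⟨hv1, hv2, hvi⟩
    obtain ⟨i1, i2⟩ := hfull hu1 hu2 hv1 hv2
    have hbd : IntegrableOn (fun x => √(vDensity u1 u2 x) * √(vDensity v1 v2 x)) Ω := by
      refine integrableOn (Continuous.continuousOn ?_)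
      have := continuous_sdivX hu2
      have := continuous_sdivX hv2
      have := continuous_pdx_apply hu1
      have := continuous_pdx_apply hv1
      have := hu1.continuous
      have := hu2.continuous
      have := hv1.continuous
      have := hv2.continuous
      unfold vDensity n2
      fun_prop
    rw [Bform, L2ip, ← integral_const_mul, ← integral_const_mul,
      ← integral_add (i1.const_mul _) (i2.const_mul _), mul_assoc]
    calc _ ≤ ∫ x in Ω, (17 * M + 6) * (√(vDensity u1 u2 x) * √(vDensity v1 v2 x)) := by
          rw [← Real.norm_eq_abs]
          refine norm_integral_le_of_norm_le (hbd.const_mul _) ?_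
          filter_upwards [ae_restrict_mem hΩopen.measurableSet] with x hx
          have hx' := subset_closure hx
          have h := abs_energy_density_le (η := 1) (M := M) ((hM2 x hx').trans (by simp [hMdef]))
            ((hM1 x hx').trans (by simp [hMdef])) ((hM3 x hx').trans (by simp [hMdef]))
            ((hM4 x hx').trans (by simp [hMdef])) zero_le_one u1 u2 v1 v2 x
          rwa [mul_one] at h
      _ = (17 * M + 6) * ∫ x in Ω, √(vDensity u1 u2 x) * √(vDensity v1 v2 x) :=
          integral_const_mul _ _
      _ ≤ (17 * M + 6) * (√(Vsq Ω u1 u2) * √(Vsq Ω v1 v2)) :=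
          mul_le_mul_of_nonneg_left
            (integral_sqrt_mul_sqrt_le hui hvi (vDensity_nonneg u1 u2) (vDensity_nonneg v1 v2))
            (by positivity)
  · rintro u1 u2 ⟨hu1, hu2, -⟩ h0
    obtain ⟨i1, i2⟩ := hfull hu1 hu2 hu1 hu2
    have hkorn := korn_inequality hΩopen hΩbd hu1 h0
    have cd := continuous_sdivX hu2
    have cp := continuous_pdx_apply hu1
    have ce := continuous_epsSym hu1
    have iF : IntegrableOn (fun x => sdivX u2 x ^ 2) Ω := integrableOn (by fun_prop)
    have iE : IntegrableOn (fun x => ∑ i, ∑ j, epsSym u1 i j x * epsSym u1 i j x) Ω :=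
      integrableOn (by fun_prop)
    have iG : IntegrableOn (fun x => ∑ i, ∑ j, (pdx (fun y => u1 y i) j x) ^ 2) Ω :=
      integrableOn (by fun_prop)
    have hV : Vsq Ω u1 u2 = L2ip Ω u1 u2 u1 u2
        + (∫ x in Ω, ∑ i, ∑ j, (pdx (fun y => u1 y i) j x) ^ 2)
        + ∫ x in Ω, sdivX u2 x ^ 2 := by
      have e := integral_add (i2.add iG) iF
      simp only [Pi.add_apply] at e
      rw [L2ip, ← integral_add i2 iG, ← e, Vsq]
      refine integral_congr_ae (.of_forall fun x => ?_)
      simp only [n2, Fin.sum_univ_three]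
      ring
    have hB : γ0 / 2 * (∫ x in Ω, sdivX u2 x ^ 2)
        + m * (∫ x in Ω, ∑ i, ∑ j, epsSym u1 i j x * epsSym u1 i j x)
        ≤ Bform Ω μ lam q r u1 u2 u1 u2 := by
      rw [Bform, ← integral_const_mul, ← integral_const_mul, ← integral_const_mul,
        ← integral_add (iF.const_mul _) (iE.const_mul _)]
      refine setIntegral_mono_on ((iF.const_mul _).add (iE.const_mul _)) (i1.const_mul _)
        hΩopen.measurableSet fun x hx => ?_
      have hx' := subset_closure hx
      have hE : 0 ≤ ∑ i, ∑ j, epsSym u1 i j x * epsSym u1 i j x :=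
        Finset.sum_nonneg fun i _ => Finset.sum_nonneg fun j _ => mul_self_nonneg _
      have h1 := hM0 x hx' (sdivX u1 x) (sdivX u2 x)
      have h2 := mul_le_mul_of_nonneg_right (hm x hx') hE
      have h3 := mul_nonneg hγ0.le (sq_nonneg (sdivX u1 x))
      linarith
    have hL : 0 ≤ L2ip Ω u1 u2 u1 u2 := integral_nonneg fun x =>
      add_nonneg (Finset.sum_nonneg fun i _ => mul_self_nonneg _)
        (Finset.sum_nonneg fun i _ => mul_self_nonneg _)
    have hG : 0 ≤ ∫ x in Ω, ∑ i, ∑ j, (pdx (fun y => u1 y i) j x) ^ 2 := integral_nonneg fun x =>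
      Finset.sum_nonneg fun i _ => Finset.sum_nonneg fun j _ => sq_nonneg _
    have hF : 0 ≤ ∫ x in Ω, sdivX u2 x ^ 2 := integral_nonneg fun x => sq_nonneg _
    have c1 := mul_le_mul_of_nonneg_right (min_le_left (γ0 / 2) (min (m / 2) 1)) hF
    have c2 := mul_le_mul_of_nonneg_right
      ((min_le_right (γ0 / 2) (min (m / 2) 1)).trans (min_le_left _ _)) hG
    have c3 := mul_le_mul_of_nonneg_right
      ((min_le_right (γ0 / 2) (min (m / 2) 1)).trans (min_le_right _ _)) hL
    have c4 := mul_le_mul_of_nonneg_left hkorn (half_pos hm0).le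
    rw [hV, mul_add, mul_add]
    linarith

end
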